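/- arXiv:1606.04854 — 3 statements merged into one kernel-verified Lean document; each statement's English description precedes it below -/
import Mathlib

section
/- (Lemma 1) For every real h, Z(h) ≥ Z(0), and Z(0) > 0. -/
open MeasureTheory

theorem integrable_exp_quartic {m l : ℝ} (hm : 0 < m) (hl : 0 ≤ l) (h : ℝ) :
    Integrable fun φ : ℝ ↦ Real.exp (-(m / 2) * φ ^ 2 - (l / 24) * φ ^ 4 - h * φ) := by
  refine ((integrable_exp_neg_mul_sq (b := m / 4) (by positivity)).const_mul
    (Real.exp (h ^ 2 / m))).mono' (by fun_prop) (.of_forall fun φ ↦ ?_)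
  rw [Real.norm_eq_abs, Real.abs_exp, ← Real.exp_add, Real.exp_le_exp]
  have hsq : m / 4 * φ ^ 2 + h * φ + h ^ 2 / m = m * (φ / 2 + h / m) ^ 2 := by
    field_simp
    ring
  have h_nonneg : 0 ≤ m * (φ / 2 + h / m) ^ 2 := by positivity
  have h_quartic : 0 ≤ l / 24 * φ ^ 4 := by positivity
  linarith

theorem two_mul_exp_le_exp_add_exp (a b : ℝ) :
    2 * Real.exp a ≤ Real.exp (a - b) + Real.exp (a + b) := by
  have hcosh := Real.one_le_cosh b
  rw [Real.cosh_eq] at hcosh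
  rw [sub_eq_add_neg, Real.exp_add, Real.exp_add]
  nlinarith [Real.exp_pos a]

/-- Lemma 1: For every real `h`, `Z(h) ≥ Z(0)`, and `Z(0) > 0`. -/
theorem stmt_2 (m0sq lam : ℝ) (hm : 0 < m0sq) (hlam : 0 < lam)
    (Z : ℝ → ℝ)
    (hZ : ∀ h : ℝ, Z h =
      ∫ φ : ℝ, Real.exp (-(m0sq / 2) * φ ^ 2 - (lam / 24) * φ ^ 4 - h * φ))
    (h : ℝ) :
    Z h ≥ Z 0 ∧ 0 < Z 0 := by
  have hint := integrable_exp_quartic hm hlam.le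
  constructor
  · have hneg : Z (-h) = Z h := by
      rw [hZ, hZ, ← integral_neg_eq_self]
      congr 1 with φ
      ring_nf
    have hle : 2 * Z 0 ≤ Z h + Z (-h) := by
      rw [hZ, hZ, hZ, ← integral_const_mul, ← integral_add (hint h) (hint (-h))]
      refine integral_mono ((hint 0).const_mul 2) ((hint h).add (hint (-h))) fun φ ↦ ?_
      have hpair := two_mul_exp_le_exp_add_exp
        (-(m0sq / 2) * φ ^ 2 - (lam / 24) * φ ^ 4) (h * φ)
      simpa using hpair
    linarith
  · rw [hZ]
    exact integral_exp_pos (hint 0)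
end

section
/- (Theorem 2) If the function h ↦ ln Z(h) is μ-integrable (so that the average free energy F_q = ∫ ln Z(h) dμ(h) is well defined), then the one-sided derivative of Φ at the origin exists and F_q = -lim_{s→0⁺} (Φ(s) - Φ(0))/s. -/
open MeasureTheory

lemma abs_exp_sub_one_le_of_le {x C : ℝ} (hC : 0 ≤ C) (hx : x ≤ C) :
    |Real.exp x - 1| ≤ |x| * Real.exp C := by
  have h1 := Real.add_one_le_exp x
  have h2 : 1 ≤ Real.exp C := Real.one_le_exp hC
  rcases le_total 0 x with h | h
  · have h3 := Real.add_one_le_exp (-x)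
    have h4 : Real.exp (-x) * Real.exp x = 1 := by rw [← Real.exp_add]; simp
    have h5 : Real.exp x ≤ Real.exp C := Real.exp_le_exp.2 hx
    rw [abs_of_nonneg (by linarith), abs_of_nonneg h]
    nlinarith [Real.exp_pos x]
  · have h3 : Real.exp x ≤ 1 := Real.exp_le_one_iff.2 h
    rw [abs_of_nonpos (by linarith), abs_of_nonpos h]
    nlinarith

/-- The right derivative at the origin of the Laplace transform of an integrable function that is
bounded below. -/
lemma tendsto_integral_exp_neg_mul_sub_div {Ω : Type*} [MeasurableSpace Ω] {μ : Measure Ω}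
    [IsFiniteMeasure μ] {f : Ω → ℝ} (hf : Integrable f μ) {C : ℝ} (hC : 0 ≤ C)
    (hfC : ∀ x, -C ≤ f x) :
    Filter.Tendsto
      (fun s : ℝ => ((∫ x, Real.exp (-s * f x) ∂μ) - ∫ x, Real.exp (-0 * f x) ∂μ) / s)
      (nhdsWithin 0 (Set.Ioi 0)) (nhds (-(∫ x, f x ∂μ))) := by
  have hmeas (s : ℝ) : AEStronglyMeasurable (fun x => Real.exp (-s * f x)) μ :=
    Real.continuous_exp.comp_aestronglyMeasurable (hf.1.const_mul (-s))
  have hint (s : ℝ) (hs : 0 ≤ s) : Integrable (fun x => Real.exp (-s * f x)) μ := by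
    refine Integrable.of_bound (hmeas s) (Real.exp (s * C)) (Filter.Eventually.of_forall fun x => ?_)
    rw [Real.norm_eq_abs, Real.abs_exp, Real.exp_le_exp]
    nlinarith [hfC x]
  have key : Filter.Tendsto (fun s : ℝ => ∫ x, (Real.exp (-s * f x) - 1) / s ∂μ)
      (nhdsWithin 0 (Set.Ioi 0)) (nhds (∫ x, -f x ∂μ)) := by
    refine tendsto_integral_filter_of_dominated_convergence (fun x => |f x| * Real.exp C)
      (Filter.Eventually.of_forall fun s => ?_) ?_ (hf.abs.mul_const _)
      (Filter.Eventually.of_forall fun x => ?_)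
    · simp only [div_eq_mul_inv]
      exact ((hmeas s).sub aestronglyMeasurable_const).mul_const s⁻¹
    · filter_upwards [Ioo_mem_nhdsGT (zero_lt_one (α := ℝ))] with s hs
      refine Filter.Eventually.of_forall fun x => ?_
      have h := abs_exp_sub_one_le_of_le (x := -s * f x) hC
        (by nlinarith [hfC x, hs.1, hs.2])
      rw [abs_mul, abs_neg, abs_of_pos hs.1] at h
      rw [Real.norm_eq_abs, abs_div, abs_of_pos hs.1, div_le_iff₀ hs.1]
      linarith
    · have hd : HasDerivAt (fun s : ℝ => Real.exp (-s * f x)) (-f x) 0 := by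
        simpa using (((hasDerivAt_id (0 : ℝ)).neg.mul_const (f x)).exp)
      refine (hd.tendsto_slope_zero_right).congr fun s => ?_
      simp [div_eq_inv_mul]
  rw [integral_neg] at key
  refine key.congr' ?_
  filter_upwards [self_mem_nhdsWithin] with s hs
  rw [integral_div, ← integral_sub (hint s (le_of_lt hs)) (hint 0 le_rfl)]
  simp

lemma integrable_exp_neg_quartic {a b : ℝ} (ha : 0 < a) (hb : 0 ≤ b) (h : ℝ) :
    Integrable fun φ : ℝ => Real.exp (-a * φ ^ 2 - b * φ ^ 4 - h * φ) := by
  refine ((integrable_exp_neg_mul_sq (half_pos ha)).const_mul (Real.exp (h ^ 2 / (2 * a)))).mono'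
    (by fun_prop) (Filter.Eventually.of_forall fun φ => ?_)
  rw [Real.norm_eq_abs, Real.abs_exp, ← Real.exp_add, Real.exp_le_exp]
  have h1 : h ^ 2 / (2 * a) + a / 2 * φ ^ 2 + h * φ = (h + a * φ) ^ 2 / (2 * a) := by
    field_simp
    ring
  have h2 : 0 ≤ (h + a * φ) ^ 2 / (2 * a) := by positivity
  have h3 : 0 ≤ b * φ ^ 4 := by positivity
  linarith

/-- Without a source term, the quartic partition function is minimal. -/
lemma integral_exp_neg_quartic_zero_le {a b : ℝ} (ha : 0 < a) (hb : 0 ≤ b) (h : ℝ) :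
    ∫ φ : ℝ, Real.exp (-a * φ ^ 2 - b * φ ^ 4 - 0 * φ) ≤
      ∫ φ : ℝ, Real.exp (-a * φ ^ 2 - b * φ ^ 4 - h * φ) := by
  have hsymm : ∫ φ : ℝ, Real.exp (-a * φ ^ 2 - b * φ ^ 4 - (-h) * φ) =
      ∫ φ : ℝ, Real.exp (-a * φ ^ 2 - b * φ ^ 4 - h * φ) := by
    rw [← integral_neg_eq_self]
    refine integral_congr_ae (Filter.Eventually.of_forall fun φ => ?_)
    ring_nf
  have hi := integrable_exp_neg_quartic ha hb
  have hmono : ∫ φ : ℝ, 2 * Real.exp (-a * φ ^ 2 - b * φ ^ 4 - 0 * φ) ≤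
      ∫ φ : ℝ, (Real.exp (-a * φ ^ 2 - b * φ ^ 4 - h * φ) +
        Real.exp (-a * φ ^ 2 - b * φ ^ 4 - (-h) * φ)) := by
    refine integral_mono ((hi 0).const_mul 2) ((hi h).add (hi (-h))) fun φ => ?_
    have hfactor (t : ℝ) : Real.exp (-a * φ ^ 2 - b * φ ^ 4 - t * φ) =
        Real.exp (-a * φ ^ 2 - b * φ ^ 4) * Real.exp (-(t * φ)) := by
      rw [← Real.exp_add, sub_eq_add_neg _ (t * φ)]
    have h1 := Real.add_one_le_exp (-(h * φ))
    have h2 := Real.add_one_le_exp (-(-h * φ))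
    have h3 := Real.exp_pos (-a * φ ^ 2 - b * φ ^ 4)
    simp only [hfactor h, hfactor (-h), zero_mul, sub_zero]
    nlinarith
  rw [integral_const_mul, integral_add (hi h) (hi (-h)), hsymm] at hmono
  linarith

/-- Theorem 2: If `h ↦ ln Z(h)` is `μ`-integrable (so that the average
free energy `F_q = ∫ ln Z(h) dμ(h)` is well defined), then the one-sided derivative of
`Φ` at the origin exists and `F_q = -lim_{s→0⁺} (Φ(s) - Φ(0))/s`. -/
theorem stmt_6 (m0sq lam : ℝ) (hm : 0 < m0sq) (hlam : 0 < lam)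
    (Z : ℝ → ℝ)
    (hZ : ∀ h : ℝ, Z h =
      ∫ φ : ℝ, Real.exp (-(m0sq / 2) * φ ^ 2 - (lam / 24) * φ ^ 4 - h * φ))
    (μ : Measure ℝ) [IsProbabilityMeasure μ]
    (hlog : Integrable (fun h : ℝ => Real.log (Z h)) μ)
    (Φ : ℝ → ℝ)
    (hΦ : ∀ s : ℝ, 0 ≤ s → Φ s = ∫ h : ℝ, Real.exp (-s * Real.log (Z h)) ∂μ) :
    Filter.Tendsto (fun s : ℝ => (Φ s - Φ 0) / s) (nhdsWithin 0 (Set.Ioi 0))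
      (nhds (-(∫ h : ℝ, Real.log (Z h) ∂μ))) := by
  have hb : 0 ≤ lam / 24 := by positivity
  have hZ0 : 0 < Z 0 := by
    rw [hZ]
    exact integral_exp_pos (integrable_exp_neg_quartic (half_pos hm) hb 0)
  have hle (h : ℝ) : Z 0 ≤ Z h := by
    rw [hZ, hZ]
    exact integral_exp_neg_quartic_zero_le (half_pos hm) hb h
  refine (tendsto_integral_exp_neg_mul_sub_div hlog (abs_nonneg (Real.log (Z 0)))
    fun h => (neg_abs_le _).trans (Real.log_le_log hZ0 (hle h))).congr' ?_
  filter_upwards [self_mem_nhdsWithin] with s hs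
  rw [hΦ s (le_of_lt hs), hΦ 0 le_rfl]
end

section
/- If the support of μ is contained in the interval [-r, r] for some r > 0, then for every integer k ≥ 1, E[Zᵏ] ≤ exp(k·C_λ·r^{4/3}) · (∫_ℝ exp(-(m₀²/2)φ²) dφ)ᵏ, where C_λ = (3/4)·(3!/λ)^{1/3}. -/
open MeasureTheory

/-- Young's inequality with exponents `4/3` and `4`, in scaled form. -/
lemma neg_quartic_sub_linear_le {lam r h : ℝ} (hlam : 0 < lam) (hr : 0 ≤ r) (hh : |h| ≤ r)
    (x : ℝ) :
    -(lam / 24) * x ^ 4 - h * x ≤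
      (3 / 4) * (6 / lam) ^ ((1 : ℝ) / 3) * r ^ ((4 : ℝ) / 3) := by
  obtain ⟨a, ha⟩ : ∃ a, a = (6 / lam) ^ ((1 : ℝ) / 3) := ⟨_, rfl⟩
  obtain ⟨s, hs⟩ : ∃ s, s = r ^ ((1 : ℝ) / 3) := ⟨_, rfl⟩
  have ha0 : 0 < a := ha ▸ by positivity
  have ha3 : a ^ 3 = 6 / lam := by
    rw [ha, ← Real.rpow_mul_natCast (by positivity)]; norm_num
  have hs3 : s ^ 3 = r := by
    rw [hs, ← Real.rpow_mul_natCast hr]; norm_num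
  have hs4 : s ^ 4 = r ^ ((4 : ℝ) / 3) := by
    rw [hs, ← Real.rpow_mul_natCast hr]; norm_num
  rw [← ha, ← hs4]
  have hl : lam * a ^ 3 = 6 := by rw [ha3]; field_simp
  have hx : -(h * x) ≤ s ^ 3 * |x| := by
    rw [hs3]
    calc -(h * x) ≤ |h * x| := neg_le_abs _
      _ = |h| * |x| := abs_mul h x
      _ ≤ r * |x| := by gcongr
  obtain ⟨y, hy⟩ : ∃ y, |x| = a * y := ⟨|x| / a, by field_simp⟩
  have hx4 : lam / 24 * x ^ 4 = a * y ^ 4 / 4 := by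
    rw [← Even.pow_abs (by decide : Even 4) x, hy]
    linear_combination (a * y ^ 4 / 24) * hl
  have key : 0 ≤ a * ((y ^ 2 - s ^ 2) ^ 2 + 2 * s ^ 2 * (y - s) ^ 2) := by positivity
  rw [hy] at hx
  nlinarith

/-- If the support of `μ` is contained in `[-r, r]` for some `r > 0`,
then for every integer `k ≥ 1`,
`E[Zᵏ] ≤ exp(k·C_λ·r^{4/3}) · (∫ exp(-(m₀²/2)φ²) dφ)ᵏ`,
where `C_λ = (3/4)·(3!/λ)^{1/3}`. -/
theorem stmt_10 (m0sq lam : ℝ) (hm : 0 < m0sq) (hlam : 0 < lam)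
    (Z : ℝ → ℝ)
    (hZ : ∀ h : ℝ, Z h =
      ∫ φ : ℝ, Real.exp (-(m0sq / 2) * φ ^ 2 - (lam / 24) * φ ^ 4 - h * φ))
    (μ : Measure ℝ) [IsProbabilityMeasure μ]
    (r : ℝ) (hr : 0 < r) (hsupp : μ (Set.Icc (-r) r)ᶜ = 0)
    (k : ℕ) (hk : 1 ≤ k) :
    (∫ h : ℝ, Z h ^ k ∂μ) ≤
      Real.exp ((k : ℝ) * ((3 / 4) * (6 / lam) ^ ((1 : ℝ) / 3)) * r ^ ((4 : ℝ) / 3)) *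
        (∫ φ : ℝ, Real.exp (-(m0sq / 2) * φ ^ 2)) ^ k := by
  have hgauss : Integrable fun φ : ℝ => Real.exp (-(m0sq / 2) * φ ^ 2) :=
    integrable_exp_neg_mul_sq (by positivity)
  set C : ℝ := (3 / 4) * (6 / lam) ^ ((1 : ℝ) / 3) with hC
  set G : ℝ := ∫ φ : ℝ, Real.exp (-(m0sq / 2) * φ ^ 2)
  have hZnonneg (h : ℝ) : 0 ≤ Z h := by
    rw [hZ]; exact integral_nonneg fun φ => (Real.exp_pos _).le
  have hZle (h : ℝ) (hh : h ∈ Set.Icc (-r) r) :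
      Z h ≤ Real.exp (C * r ^ ((4 : ℝ) / 3)) * G := by
    rw [hZ, ← integral_const_mul]
    refine integral_mono_of_nonneg (.of_forall fun φ => (Real.exp_pos _).le)
      (hgauss.const_mul _) (.of_forall fun φ => ?_)
    simp only [← Real.exp_add]
    have := neg_quartic_sub_linear_le hlam hr.le (abs_le.mpr hh) φ
    rw [← hC] at this
    exact Real.exp_le_exp.mpr (by linarith)
  have hsupp' : ∀ᵐ h ∂μ, h ∈ Set.Icc (-r) r := hsupp
  calc (∫ h : ℝ, Z h ^ k ∂μ)
      ≤ ∫ _ : ℝ, (Real.exp (C * r ^ ((4 : ℝ) / 3)) * G) ^ k ∂μ := by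
        refine integral_mono_of_nonneg (.of_forall fun h => pow_nonneg (hZnonneg h) k)
          (integrable_const _) ?_
        filter_upwards [hsupp'] with h hh
        exact pow_le_pow_left₀ (hZnonneg h) (hZle h hh) k
    _ = Real.exp ((k : ℝ) * C * r ^ ((4 : ℝ) / 3)) * G ^ k := by
        rw [integral_const, probReal_univ, one_smul, mul_pow, ← Real.exp_nat_mul, mul_assoc (k : ℝ)]
end
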